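/- arXiv:0803.1876 — 2 statements merged into one kernel-verified Lean document; each statement's English description precedes it below -/
import Mathlib

section
/- Let f : ℝ → ℝ³ be a C^∞ embedding of period L parametrized by arc length, and fix s₀ with κ(s₀) = |f''(s₀)| > 0; let C(s₀) be the osculating circle of f at s₀. Let P ∉ f([0,L]) with P ∉ C(s₀), let r > 0, and set f̃ = I_{P,r}∘f. Then f̃'(s₀) × f̃''(s₀) ≠ 0 (the inverted curve has nonzero curvature at s₀), and the osculating circle of f̃ at s₀ is the image I_{P,r}(C(s₀)); i.e. inversions map osculating circles to osculating circles. -/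
noncomputable section
open Real

/-- Euclidean 3-space. -/
abbrev E3 : Type := EuclideanSpace ℝ (Fin 3)

/-- The dot product of two vectors in `E3`. -/
def dot3 (u v : E3) : ℝ := u 0 * v 0 + u 1 * v 1 + u 2 * v 2

/-- The cross product of two vectors in `E3`. -/
def cross3 (u v : E3) : E3 :=
  (WithLp.equiv 2 (Fin 3 → ℝ)).symm
    ![u 1 * v 2 - u 2 * v 1, u 2 * v 0 - u 0 * v 2, u 0 * v 1 - u 1 * v 0]

/-- The determinant `det(u, v, w)` of three vectors in `E3`. -/
def det3 (u v w : E3) : ℝ := dot3 u (cross3 v w)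

/-- The writhe of a closed curve `g` of period `L`, given by the Gauss integral. -/
def writhe (g : ℝ → E3) (L : ℝ) : ℝ :=
  (1 / (4 * π)) * ∫ s in (0:ℝ)..L, ∫ t in (0:ℝ)..L,
    det3 (deriv g s) (deriv g t) (g s - g t) / ‖g s - g t‖ ^ 3

/-- The inversion in the sphere of center `P` and radius `r`. -/
def inv3 (P : E3) (r : ℝ) (x : E3) : E3 := P + (r ^ 2 / ‖x - P‖ ^ 2) • (x - P)

/-- The differential of the inversion `inv3 P r` at `x`, applied to `v`. -/
def dInv (P : E3) (r : ℝ) (x v : E3) : E3 :=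
  (r ^ 2 / ‖x - P‖ ^ 2) • (v - ((2 * dot3 (x - P) v) / ‖x - P‖ ^ 2) • (x - P))

/-- The total twist of a closed curve `g` of period `L` with unit normal framing `w`. -/
def twist (g w : ℝ → E3) (L : ℝ) : ℝ :=
  (1 / (2 * π)) * ∫ s in (0:ℝ)..L,
    dot3 (deriv w s) (cross3 ((‖deriv g s‖)⁻¹ • deriv g s) (w s))

/-- The principal normal `e₂ = f''/κ` of an arc-length parametrized curve. -/
def e2 (f : ℝ → E3) (s : ℝ) : E3 := (‖deriv (deriv f) s‖)⁻¹ • deriv (deriv f) s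

/-- The binormal `e₃ = e₁ × e₂` of an arc-length parametrized curve. -/
def e3 (f : ℝ → E3) (s : ℝ) : E3 := cross3 (deriv f s) (e2 f s)

/-- The torsion `τ = e₂'·e₃` of an arc-length parametrized curve. -/
def torsionArc (f : ℝ → E3) (s : ℝ) : ℝ := dot3 (deriv (e2 f) s) (e3 f s)

/-- The total torsion `Tω = (1/2π) ∫ τ` of an arc-length parametrized closed curve. -/
def totalTorsionArc (f : ℝ → E3) (L : ℝ) : ℝ :=
  (1 / (2 * π)) * ∫ s in (0:ℝ)..L, torsionArc f s

/-- The torsion `τ_g = det(g', g'', g''')/|g' × g''|²` of a regular curve. -/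
def torsionGen (g : ℝ → E3) (s : ℝ) : ℝ :=
  det3 (deriv g s) (deriv (deriv g) s) (deriv (deriv (deriv g)) s) /
    ‖cross3 (deriv g s) (deriv (deriv g) s)‖ ^ 2

/-- The total torsion `Tω = (1/2π) ∫ τ_g |g'|` of a regular closed curve. -/
def totalTorsionGen (g : ℝ → E3) (L : ℝ) : ℝ :=
  (1 / (2 * π)) * ∫ s in (0:ℝ)..L, torsionGen g s * ‖deriv g s‖

/-- The osculating circle at `s` of an arc-length parametrized curve with `κ(s) > 0`:
the circle of center `f(s) + (1/κ(s)) e₂(s)` and radius `1/κ(s)` in the plane through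
`f(s)` spanned by `e₁(s)` and `e₂(s)`. -/
def osculatingCircleArc (f : ℝ → E3) (s : ℝ) : Set E3 :=
  {y | (∃ a b : ℝ, y = f s + a • deriv f s + b • e2 f s) ∧
    ‖y - (f s + (‖deriv (deriv f) s‖)⁻¹ • e2 f s)‖ = (‖deriv (deriv f) s‖)⁻¹}

/-- The curvature tube of `f`: the union of all osculating circles. -/
def curvatureTube (f : ℝ → E3) : Set E3 := ⋃ s : ℝ, osculatingCircleArc f s

/-- The osculating circle at `s` of a regular curve `g` with `g'(s) × g''(s) ≠ 0`:
the circle of center `g(s) + (1/κ_g(s))·N(s)` (where `κ_g = |g' × g''|/|g'|³` and `N`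
is the unit principal normal, in the direction `(g' × g'') × g'`) and radius
`1/κ_g(s)`, lying in the plane through `g(s)` spanned by `g'(s)` and `g''(s)`. -/
def osculatingCircleGen (g : ℝ → E3) (s : ℝ) : Set E3 :=
  let v : E3 := deriv g s
  let a : E3 := deriv (deriv g) s
  let κ : ℝ := ‖cross3 v a‖ / ‖v‖ ^ 3
  let N : E3 := (‖cross3 (cross3 v a) v‖)⁻¹ • cross3 (cross3 v a) v
  {y | (∃ p q : ℝ, y = g s + p • v + q • a) ∧ ‖y - (g s + κ⁻¹ • N)‖ = κ⁻¹}

open scoped InnerProductSpace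

theorem inner_eq_dot3 (u v : E3) : ⟪u, v⟫_ℝ = dot3 u v := by
  simp [dot3, PiLp.inner_apply, Fin.sum_univ_three]
  ring

theorem norm_sq_eq_dot3 (u : E3) : ‖u‖ ^ 2 = dot3 u u := by
  rw [← inner_eq_dot3, real_inner_self_eq_norm_sq]

theorem cross3_cross3_left (v a : E3) :
    cross3 (cross3 v a) v = ‖v‖ ^ 2 • a - ⟪v, a⟫_ℝ • v := by
  rw [norm_sq_eq_dot3, inner_eq_dot3]
  ext i
  fin_cases i <;> simp [cross3, dot3] <;> ring

theorem norm_cross3_sq (v a : E3) :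
    ‖cross3 v a‖ ^ 2 = ‖v‖ ^ 2 * ‖a‖ ^ 2 - ⟪v, a⟫_ℝ ^ 2 := by
  simp only [norm_sq_eq_dot3, inner_eq_dot3]
  simp [cross3, dot3]
  ring

/-- If `t` is a unit vector, `b` is orthogonal to `t`, and `l` is positive, the cross product of
`l t` and `l (b + c t)` has norm `l² |b|`. -/
theorem norm_cross3_of_orthogonal {t b : E3} {l : ℝ} (c : ℝ) (ht : ‖t‖ = 1)
    (htb : ⟪t, b⟫_ℝ = 0) :
    ‖cross3 (l • t) (l • (b + c • t))‖ = l ^ 2 * ‖b‖ := by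
  rw [← sq_eq_sq₀ (norm_nonneg _) (by positivity), norm_cross3_sq]
  simp only [← real_inner_self_eq_norm_sq, mul_pow]
  have htt : ⟪t, t⟫_ℝ = 1 := by simp [ht]
  simp only [inner_add_left, inner_add_right, real_inner_smul_left, real_inner_smul_right,
    real_inner_comm t b, htb, htt]
  ring

/-- The circle through `x` tangent to the unit vector `t` with curvature vector `b`. -/
def curvatureCircle (x t b : E3) : Set E3 :=
  {y | ∃ p q : ℝ, y = x + (p • t + q • b) ∧ p ^ 2 + q ^ 2 * ‖b‖ ^ 2 = 2 * q}

theorem norm_sub_curvature_center_iff {t b : E3} {l : ℝ} (hl : 0 < l) (ht : ‖t‖ = 1)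
    (htb : ⟪t, b⟫_ℝ = 0) (hb : b ≠ 0) (p q : ℝ) :
    ‖l • (p • t + q • b) - (l * (‖b‖ ^ 2)⁻¹) • b‖ = l * ‖b‖⁻¹ ↔
      p ^ 2 + q ^ 2 * ‖b‖ ^ 2 = 2 * q := by
  have hb' : 0 < ‖b‖ := norm_pos_iff.mpr hb
  have htt : ⟪t, t⟫_ℝ = 1 := by simp [ht]
  rw [← sq_eq_sq₀ (norm_nonneg _) (by positivity), ← real_inner_self_eq_norm_sq]
  simp only [inner_add_left, inner_add_right, inner_sub_left, inner_sub_right,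
    real_inner_smul_left, real_inner_smul_right, real_inner_comm t b, htb, htt,
    real_inner_self_eq_norm_sq b]
  have key : l ^ 2 * (p ^ 2 + q ^ 2 * ‖b‖ ^ 2 - 2 * q) =
      l * (p * (l * (p * 1 + q * 0)) + q * (l * (p * 0 + q * ‖b‖ ^ 2))) -
        l * (‖b‖ ^ 2)⁻¹ * (l * (p * 0 + q * ‖b‖ ^ 2)) -
        (l * (p * 0 + q * ‖b‖ ^ 2) * (l * (‖b‖ ^ 2)⁻¹)
          - l * (‖b‖ ^ 2)⁻¹ * (l * (‖b‖ ^ 2)⁻¹ * ‖b‖ ^ 2)) - (l * ‖b‖⁻¹) ^ 2 := by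
    field_simp
    ring
  constructor
  · intro h
    have h0 : l ^ 2 * (p ^ 2 + q ^ 2 * ‖b‖ ^ 2 - 2 * q) = 0 := by
      rw [key]; linear_combination h
    have := (mul_eq_zero.mp h0).resolve_left (by positivity)
    linarith
  · intro h
    rw [h, sub_self, mul_zero] at key
    linear_combination -key

theorem osculatingCircleArc_eq (f : ℝ → E3) (s : ℝ) (hT : ‖deriv f s‖ = 1)
    (hA : deriv (deriv f) s ≠ 0) (hTA : ⟪deriv f s, deriv (deriv f) s⟫_ℝ = 0) :
    osculatingCircleArc f s = curvatureCircle (f s) (deriv f s) (deriv (deriv f) s) := by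
  have hk : ‖deriv (deriv f) s‖ ≠ 0 := norm_ne_zero_iff.mpr hA
  have hiff := norm_sub_curvature_center_iff one_pos hT hTA hA
  ext y
  simp only [osculatingCircleArc, curvatureCircle, e2, Set.mem_ofPred_eq]
  constructor
  · rintro ⟨⟨p, q, rfl⟩, h⟩
    refine ⟨p, q * ‖deriv (deriv f) s‖⁻¹, by module, ?_⟩
    rw [← hiff, one_mul ‖_‖⁻¹]
    refine (congrArg norm ?_).trans h
    match_scalars <;> field_simp
    ring
  · rintro ⟨p, q, rfl, h⟩
    refine ⟨⟨p, q * ‖deriv (deriv f) s‖, ?_⟩, ?_⟩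
    · match_scalars <;> field_simp
    · rw [← hiff, one_mul ‖_‖⁻¹] at h
      refine (congrArg norm ?_).trans h
      match_scalars <;> field_simp
      ring

theorem osculatingCircleGen_eq (g : ℝ → E3) (s : ℝ) {t b : E3} {l c : ℝ} (hl : 0 < l)
    (ht : ‖t‖ = 1) (htb : ⟪t, b⟫_ℝ = 0) (hb : b ≠ 0) (hv : deriv g s = l • t)
    (ha : deriv (deriv g) s = l • (b + c • t)) :
    osculatingCircleGen g s =
      {y | ∃ p q : ℝ, y = g s + l • (p • t + q • b) ∧ p ^ 2 + q ^ 2 * ‖b‖ ^ 2 = 2 * q} := by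
  have hb' : 0 < ‖b‖ := norm_pos_iff.mpr hb
  have htt : ⟪t, t⟫_ℝ = 1 := by simp [ht]
  have hiff := norm_sub_curvature_center_iff hl ht htb hb
  have hlv : ‖l • t‖ = l := by rw [norm_smul, ht, mul_one, Real.norm_of_nonneg hl.le]
  have hn : cross3 (cross3 (l • t) (l • (b + c • t))) (l • t) = l ^ 3 • b := by
    rw [cross3_cross3_left, hlv]
    simp only [inner_add_right, real_inner_smul_left, real_inner_smul_right, htb, htt]
    module
  have hnn : ‖l ^ 3 • b‖ = l ^ 3 * ‖b‖ := by
    rw [norm_smul, Real.norm_of_nonneg (by positivity)]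
  have hκ : (l ^ 2 * ‖b‖ / l ^ 3)⁻¹ = l * ‖b‖⁻¹ := by field_simp
  ext y
  simp only [osculatingCircleGen, hv, ha, hn, hnn, hlv, norm_cross3_of_orthogonal c ht htb, hκ,
    Set.mem_ofPred_eq]
  constructor
  · rintro ⟨⟨p, q, rfl⟩, h⟩
    refine ⟨p + q * c, q, by module, ?_⟩
    rw [← hiff]
    refine (congrArg norm ?_).trans h
    match_scalars <;> field_simp
    ring
  · rintro ⟨p, q, rfl, h⟩
    refine ⟨⟨p - q * c, q, by module⟩, ?_⟩
    rw [← hiff] at h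
    refine (congrArg norm ?_).trans h
    match_scalars <;> field_simp
    ring

theorem hasDerivAt_inv3_comp {f : ℝ → E3} {f' : E3} {s : ℝ} {P : E3} (r : ℝ)
    (hf : HasDerivAt f f' s) (hP : f s ≠ P) :
    HasDerivAt (fun s => inv3 P r (f s))
      ((r ^ 2 / ‖f s - P‖ ^ 2) •
        (f' - (2 * ⟪f s - P, f'⟫_ℝ / ‖f s - P‖ ^ 2) • (f s - P))) s := by
  have hw : HasDerivAt (fun s => f s - P) f' s := hf.sub_const P
  have hρ : ‖f s - P‖ ≠ 0 := norm_ne_zero_iff.mpr (sub_ne_zero.mpr hP)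
  have h := (((hasDerivAt_const s (r ^ 2)).div hw.norm_sq (pow_ne_zero 2 hρ)).smul hw).const_add P
  refine h.congr_deriv ?_
  simp only [Pi.div_apply]
  match_scalars <;> field_simp <;> ring

theorem hasDerivAt_deriv_inv3_comp {f f' : ℝ → E3} {f'' : E3} {s : ℝ} {P : E3} (r : ℝ)
    (hf : HasDerivAt f (f' s) s) (hf' : HasDerivAt f' f'' s) (hP : f s ≠ P) :
    HasDerivAt (fun s => (r ^ 2 / ‖f s - P‖ ^ 2) •
        (f' s - (2 * ⟪f s - P, f' s⟫_ℝ / ‖f s - P‖ ^ 2) • (f s - P)))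
      ((r ^ 2 / ‖f s - P‖ ^ 2) • (f'' - (4 * ⟪f s - P, f' s⟫_ℝ / ‖f s - P‖ ^ 2) • f' s +
        (8 * ⟪f s - P, f' s⟫_ℝ ^ 2 / ‖f s - P‖ ^ 4 -
          2 * (‖f' s‖ ^ 2 + ⟪f s - P, f''⟫_ℝ) / ‖f s - P‖ ^ 2) • (f s - P))) s := by
  have hw : HasDerivAt (fun s => f s - P) (f' s) s := hf.sub_const P
  have hρ : ‖f s - P‖ ≠ 0 := norm_ne_zero_iff.mpr (sub_ne_zero.mpr hP)
  have hc := (hasDerivAt_const s (r ^ 2)).div hw.norm_sq (pow_ne_zero 2 hρ)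
  have hd := (((hw.inner ℝ hf').const_mul 2).div hw.norm_sq (pow_ne_zero 2 hρ)).smul hw
  have h := hc.smul (hf'.sub hd)
  refine h.congr_deriv ?_
  rw [real_inner_self_eq_norm_sq]
  simp only [Pi.div_apply, Pi.sub_apply, Pi.smul_apply']
  match_scalars <;> field_simp <;> ring

/-- The unit tangent vector of the image under an inversion centred at the origin of a curve
through `w` with unit tangent vector `T`. -/
def invTangent (w T : E3) : E3 := T - (2 * ⟪w, T⟫_ℝ / ‖w‖ ^ 2) • w

/-- The curvature vector, rescaled by the conformal factor, of the image under an inversion centred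
at the origin of a curve through `w` with unit tangent vector `T` and curvature vector `A`. -/
def invCurvature (w T A : E3) : E3 :=
  A - (2 * ⟪w, T⟫_ℝ / ‖w‖ ^ 2) • T +
    (4 * ⟪w, T⟫_ℝ ^ 2 / ‖w‖ ^ 4 - 2 * (1 + ⟪w, A⟫_ℝ) / ‖w‖ ^ 2) • w

section

variable {w T A : E3}

theorem norm_invTangent (hw : w ≠ 0) (hT : ‖T‖ = 1) : ‖invTangent w T‖ = 1 := by
  have hρ : ‖w‖ ≠ 0 := norm_ne_zero_iff.mpr hw
  rw [← sq_eq_sq₀ (norm_nonneg _) zero_le_one, ← real_inner_self_eq_norm_sq, invTangent]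
  simp only [inner_sub_left, inner_sub_right, real_inner_smul_left, real_inner_smul_right,
    real_inner_self_eq_norm_sq w, real_inner_self_eq_norm_sq T, real_inner_comm w T, hT]
  field_simp
  ring

theorem inner_invTangent_invCurvature (hw : w ≠ 0) (hT : ‖T‖ = 1) (hTA : ⟪T, A⟫_ℝ = 0) :
    ⟪invTangent w T, invCurvature w T A⟫_ℝ = 0 := by
  have hρ : ‖w‖ ≠ 0 := norm_ne_zero_iff.mpr hw
  rw [invTangent, invCurvature]
  simp only [inner_add_right, inner_sub_left, inner_sub_right, real_inner_smul_left,
    real_inner_smul_right, real_inner_self_eq_norm_sq w, real_inner_self_eq_norm_sq T, real_inner_comm w T, hT, hTA]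
  field_simp
  ring

theorem norm_invCurvature_sq (hw : w ≠ 0) (hT : ‖T‖ = 1) (hTA : ⟪T, A⟫_ℝ = 0) :
    ‖invCurvature w T A‖ ^ 2 =
      ‖A‖ ^ 2 + 4 * (⟪w, A⟫_ℝ + 1) / ‖w‖ ^ 2 - 4 * ⟪w, T⟫_ℝ ^ 2 / ‖w‖ ^ 4 := by
  have hρ : ‖w‖ ≠ 0 := norm_ne_zero_iff.mpr hw
  rw [← real_inner_self_eq_norm_sq, invCurvature]
  simp only [inner_add_right, inner_add_left, inner_sub_left, inner_sub_right,
    real_inner_smul_left, real_inner_smul_right, real_inner_self_eq_norm_sq w, real_inner_self_eq_norm_sq T,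
    real_inner_self_eq_norm_sq A, real_inner_comm w T,
    real_inner_comm w A, real_inner_comm T A, hT, hTA]
  field_simp
  ring

theorem invCurvature_ne_zero {x P : E3} (hx : x ≠ P) (hT : ‖T‖ = 1) (hTA : ⟪T, A⟫_ℝ = 0)
    (hP : P ∉ curvatureCircle x T A) : invCurvature (x - P) T A ≠ 0 := by
  intro h0
  have hw : x - P ≠ 0 := sub_ne_zero.mpr hx
  have hρ : ‖x - P‖ ≠ 0 := norm_ne_zero_iff.mpr hw
  have hn := norm_invCurvature_sq hw hT hTA
  rw [h0, norm_zero] at hn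
  set w := x - P with hw_def
  have hB : A + (2 / ‖w‖ ^ 2) • w - (2 * ⟪w, T⟫_ℝ / ‖w‖ ^ 2) • T = 0 := by
    rw [← norm_eq_zero, ← sq_eq_zero_iff, ← real_inner_self_eq_norm_sq]
    simp only [inner_add_right, inner_add_left, inner_sub_left, inner_sub_right,
      real_inner_smul_left, real_inner_smul_right, real_inner_self_eq_norm_sq w, real_inner_self_eq_norm_sq T,
    real_inner_self_eq_norm_sq A, real_inner_comm w T,
      real_inner_comm w A, real_inner_comm T A, hT, hTA]
    field_simp at hn ⊢
    linear_combination -hn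
  have hwe : w = ⟪w, T⟫_ℝ • T - (‖w‖ ^ 2 / 2) • A := by
    have : w = ⟪w, T⟫_ℝ • T - (‖w‖ ^ 2 / 2) • A + (‖w‖ ^ 2 / 2) •
        (A + (2 / ‖w‖ ^ 2) • w - (2 * ⟪w, T⟫_ℝ / ‖w‖ ^ 2) • T) := by
      match_scalars <;> field_simp <;> ring
    rwa [hB, smul_zero, add_zero] at this
  refine hP ⟨-⟪w, T⟫_ℝ, ‖w‖ ^ 2 / 2, ?_, ?_⟩
  · have hPx : P = x - w := by rw [hw_def]; abel
    rw [hPx]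
    nth_rewrite 1 [hwe]
    module
  · have h1 : ⟪w, w⟫_ℝ = ⟪⟪w, T⟫_ℝ • T - (‖w‖ ^ 2 / 2) • A, ⟪w, T⟫_ℝ • T - (‖w‖ ^ 2 / 2) • A⟫_ℝ := by
      rw [← hwe]
    simp only [inner_sub_left, inner_sub_right,
      real_inner_smul_left, real_inner_smul_right, real_inner_self_eq_norm_sq w, real_inner_self_eq_norm_sq T,
      real_inner_self_eq_norm_sq A, real_inner_comm T A, hT, hTA] at h1
    linear_combination -h1

theorem norm_add_sq_of_curvature {p q : ℝ} (hT : ‖T‖ = 1) (hTA : ⟪T, A⟫_ℝ = 0)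
    (h : p ^ 2 + q ^ 2 * ‖A‖ ^ 2 = 2 * q) :
    ‖w + (p • T + q • A)‖ ^ 2 =
      ‖w‖ ^ 2 + 2 * p * ⟪w, T⟫_ℝ + 2 * q * ⟪w, A⟫_ℝ + 2 * q := by
  rw [← real_inner_self_eq_norm_sq]
  simp only [inner_add_right, inner_add_left,
    real_inner_smul_left, real_inner_smul_right, real_inner_self_eq_norm_sq w, real_inner_self_eq_norm_sq T,
    real_inner_self_eq_norm_sq A, real_inner_comm w T,
    real_inner_comm w A, real_inner_comm T A, hT, hTA]
  linear_combination h

/-- The inversion of the curvature circle, in coordinates. -/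
theorem smul_add_curvature {p q D : ℝ} (r : ℝ) (hw : w ≠ 0) (hD : D ≠ 0)
    (hD' : D = ‖w‖ ^ 2 + 2 * p * ⟪w, T⟫_ℝ + 2 * q * ⟪w, A⟫_ℝ + 2 * q) :
    (r ^ 2 / D) • (w + (p • T + q • A)) =
      (r ^ 2 / ‖w‖ ^ 2) • w + (r ^ 2 / ‖w‖ ^ 2) •
        (((‖w‖ ^ 2 * p + 2 * q * ⟪w, T⟫_ℝ) / D) • invTangent w T +
          (‖w‖ ^ 2 * q / D) • invCurvature w T A) := by
  have hρ : ‖w‖ ≠ 0 := norm_ne_zero_iff.mpr hw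
  simp only [invTangent, invCurvature]
  match_scalars
  · field_simp
    rw [hD']
    ring
  · field_simp
    ring
  · field_simp

theorem curvature_denominator_ne_zero {p q : ℝ} (hw : w ≠ 0) (hT : ‖T‖ = 1) (hTA : ⟪T, A⟫_ℝ = 0)
    (hA : A ≠ 0) (h : p ^ 2 + q ^ 2 * ‖invCurvature w T A‖ ^ 2 = 2 * q) :
    ‖w‖ ^ 2 - 2 * (p * ⟪w, T⟫_ℝ + q * (⟪w, A⟫_ℝ + 2 - 2 * ⟪w, T⟫_ℝ ^ 2 / ‖w‖ ^ 2)) + 2 * q ≠ 0 := by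
  intro h0
  have hρ : ‖w‖ ≠ 0 := norm_ne_zero_iff.mpr hw
  rw [norm_invCurvature_sq hw hT hTA] at h
  have hz : w - (p • T + q • (A + (2 / ‖w‖ ^ 2) • w - (2 * ⟪w, T⟫_ℝ / ‖w‖ ^ 2) • T)) = 0 := by
    rw [← norm_eq_zero, ← sq_eq_zero_iff, ← real_inner_self_eq_norm_sq]
    simp only [inner_add_right, inner_add_left, inner_sub_left, inner_sub_right,
      real_inner_smul_left, real_inner_smul_right, real_inner_self_eq_norm_sq w,
      real_inner_self_eq_norm_sq T, real_inner_self_eq_norm_sq A, real_inner_comm w T,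
      real_inner_comm w A, real_inner_comm T A, hT, hTA]
    field_simp at h h0 ⊢
    linear_combination ‖w‖ ^ 2 * h0 + h
  have h1 := congrArg (inner ℝ T) hz
  have h2 := congrArg (inner ℝ A) hz
  have h3 := congrArg (inner ℝ w) hz
  simp only [inner_add_right, inner_sub_right, real_inner_smul_right, inner_zero_right,
    real_inner_self_eq_norm_sq w, real_inner_self_eq_norm_sq T, real_inner_self_eq_norm_sq A,
    real_inner_comm w T, real_inner_comm w A, real_inner_comm T A, hT, hTA] at h1 h2 h3
  have hq : ‖w‖ ^ 2 = 2 * q := by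
    field_simp at h0 h3
    have : ‖w‖ ^ 2 * (‖w‖ ^ 2 - 2 * q) = 0 := by linear_combination 2 * h3 - h0
    exact sub_eq_zero.mp ((mul_eq_zero.mp this).resolve_left (by positivity))
  have hk : ‖w‖ ^ 2 * ‖A‖ ^ 2 = 0 := by
    have hq' : q = ‖w‖ ^ 2 / 2 := by linarith
    rw [hq'] at h2
    field_simp at h2
    linear_combination -h2
  simp [hρ, hA] at hk

end

theorem image_inv3_curvatureCircle {x T A P : E3} (r : ℝ) (hx : x ≠ P) (hT : ‖T‖ = 1)
    (hTA : ⟪T, A⟫_ℝ = 0) (hA : A ≠ 0) (hP : P ∉ curvatureCircle x T A) :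
    inv3 P r '' curvatureCircle x T A =
      {y | ∃ p q : ℝ, y = inv3 P r x + (r ^ 2 / ‖x - P‖ ^ 2) •
          (p • invTangent (x - P) T + q • invCurvature (x - P) T A) ∧
        p ^ 2 + q ^ 2 * ‖invCurvature (x - P) T A‖ ^ 2 = 2 * q} := by
  have hw : x - P ≠ 0 := sub_ne_zero.mpr hx
  have hρ : ‖x - P‖ ≠ 0 := norm_ne_zero_iff.mpr hw
  have hn := norm_invCurvature_sq hw hT hTA
  have hsub (u : E3) : x + u - P = x - P + u := by abel
  have himage (p q D : ℝ) (h : p ^ 2 + q ^ 2 * ‖A‖ ^ 2 = 2 * q) (hD : D ≠ 0)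
      (hD' : D = ‖x - P‖ ^ 2 + 2 * p * ⟪x - P, T⟫_ℝ + 2 * q * ⟪x - P, A⟫_ℝ + 2 * q) :
      inv3 P r (x + (p • T + q • A)) = inv3 P r x + (r ^ 2 / ‖x - P‖ ^ 2) •
        (((‖x - P‖ ^ 2 * p + 2 * q * ⟪x - P, T⟫_ℝ) / D) • invTangent (x - P) T +
          (‖x - P‖ ^ 2 * q / D) • invCurvature (x - P) T A) := by
    rw [inv3, inv3, hsub, norm_add_sq_of_curvature hT hTA h, ← hD', smul_add_curvature r hw hD hD']
    abel
  ext y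
  simp only [Set.mem_image, Set.mem_ofPred_eq]
  constructor
  · rintro ⟨_, ⟨p, q, rfl, h⟩, rfl⟩
    obtain ⟨D, hD'⟩ : ∃ D, D = ‖x - P‖ ^ 2 + 2 * p * ⟪x - P, T⟫_ℝ + 2 * q * ⟪x - P, A⟫_ℝ + 2 * q :=
      ⟨_, rfl⟩
    have hD : D ≠ 0 := by
      rw [hD', ← norm_add_sq_of_curvature hT hTA h]
      intro h0
      have h0' := norm_eq_zero.mp (sq_eq_zero_iff.mp h0)
      rw [← hsub, sub_eq_zero] at h0'
      exact hP ⟨p, q, h0'.symm, h⟩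
    refine ⟨_, _, himage p q D h hD hD', ?_⟩
    rw [hn]
    field_simp
    linear_combination ‖x - P‖ ^ 4 * h - 2 * q * ‖x - P‖ ^ 2 * hD'
  · rintro ⟨p, q, rfl, h⟩
    obtain ⟨E, hE'⟩ : ∃ E, E = ‖x - P‖ ^ 2 - 2 * (p * ⟪x - P, T⟫_ℝ + q * (⟪x - P, A⟫_ℝ + 2 -
        2 * ⟪x - P, T⟫_ℝ ^ 2 / ‖x - P‖ ^ 2)) + 2 * q := ⟨_, rfl⟩
    have hE : E ≠ 0 := hE' ▸ curvature_denominator_ne_zero hw hT hTA hA h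
    have hp0 : ((‖x - P‖ ^ 2 * p - 2 * q * ⟪x - P, T⟫_ℝ) / E) ^ 2 +
        (‖x - P‖ ^ 2 * q / E) ^ 2 * ‖A‖ ^ 2 = 2 * (‖x - P‖ ^ 2 * q / E) := by
      rw [hn] at h
      field_simp at h hE' ⊢
      linear_combination h - 2 * q * hE'
    refine ⟨_, ⟨_, _, rfl, hp0⟩, ?_⟩
    rw [himage _ _ (‖x - P‖ ^ 4 / E) hp0 (by positivity)]
    · congr 4
      · field_simp
        ring
      · field_simp
    · field_simp at hE' ⊢
      linear_combination -hE'

/-- Inversions map osculating circles to osculating circles: if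
`κ(s₀) > 0` and `P` lies neither on the knot nor on the osculating circle `C(s₀)`,
then the inverted curve `f̃ = I_{P,r} ∘ f` has nonzero curvature at `s₀` and its
osculating circle at `s₀` is `I_{P,r}(C(s₀))`. -/
theorem inversion_maps_osculating_circle
    (f : ℝ → E3) (L : ℝ) (hL : 0 < L)
    (hf : ContDiff ℝ (⊤ : ℕ∞) f) (hper : Function.Periodic f L)
    (harc : ∀ s, ‖deriv f s‖ = 1) (hinj : Set.InjOn f (Set.Ico 0 L))
    (s₀ : ℝ) (hκ : ‖deriv (deriv f) s₀‖ > 0)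
    (P : E3) (hP : P ∉ f '' Set.Icc 0 L) (hPosc : P ∉ osculatingCircleArc f s₀)
    (r : ℝ) (hr : 0 < r) :
    cross3 (deriv (fun s => inv3 P r (f s)) s₀)
        (deriv (deriv (fun s => inv3 P r (f s))) s₀) ≠ 0 ∧
      osculatingCircleGen (fun s => inv3 P r (f s)) s₀
        = inv3 P r '' osculatingCircleArc f s₀ := by
  have hx (s : ℝ) : f s ≠ P := by
    rintro rfl
    obtain ⟨y, hy, hsy⟩ := hper.exists_mem_Ico₀ hL s
    exact hP ⟨y, Set.Ico_subset_Icc_self hy, hsy.symm⟩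
  have hf1 (s : ℝ) : HasDerivAt f (deriv f s) s :=
    (hf.differentiable (by simp)).differentiableAt.hasDerivAt
  have hf' : ContDiff ℝ (⊤ : ℕ∞) (deriv f) := (contDiff_infty_iff_deriv.mp hf).2
  have hf2 : HasDerivAt (deriv f) (deriv (deriv f) s₀) s₀ :=
    (hf'.differentiable (by simp)).differentiableAt.hasDerivAt
  have hTA : ⟪deriv f s₀, deriv (deriv f) s₀⟫_ℝ = 0 := by
    have h := hf2.norm_sq
    simp only [harc] at h
    linarith [h.unique (hasDerivAt_const s₀ _)]
  have hA : deriv (deriv f) s₀ ≠ 0 := norm_pos_iff.mp hκ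
  rw [osculatingCircleArc_eq f s₀ (harc s₀) hA hTA] at hPosc ⊢
  have hw : f s₀ - P ≠ 0 := sub_ne_zero.mpr (hx s₀)
  have hρ : 0 < ‖f s₀ - P‖ := norm_pos_iff.mpr hw
  have hl : 0 < r ^ 2 / ‖f s₀ - P‖ ^ 2 := by positivity
  have hb := invCurvature_ne_zero (hx s₀) (harc s₀) hTA hPosc
  have ht := norm_invTangent hw (harc s₀)
  have htb := inner_invTangent_invCurvature hw (harc s₀) hTA
  have hv : deriv (fun s => inv3 P r (f s)) s₀ =
      (r ^ 2 / ‖f s₀ - P‖ ^ 2) • invTangent (f s₀ - P) (deriv f s₀) :=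
    (hasDerivAt_inv3_comp r (hf1 s₀) (hx s₀)).deriv
  have ha : deriv (deriv (fun s => inv3 P r (f s))) s₀ = (r ^ 2 / ‖f s₀ - P‖ ^ 2) •
      (invCurvature (f s₀ - P) (deriv f s₀) (deriv (deriv f) s₀) +
        (-2 * ⟪f s₀ - P, deriv f s₀⟫_ℝ / ‖f s₀ - P‖ ^ 2) •
          invTangent (f s₀ - P) (deriv f s₀)) := by
    have hd : deriv (fun s => inv3 P r (f s)) = _ :=
      funext fun s => (hasDerivAt_inv3_comp r (hf1 s) (hx s)).deriv
    rw [hd, (hasDerivAt_deriv_inv3_comp r (hf1 s₀) hf2 (hx s₀)).deriv, harc, invCurvature,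
      invTangent]
    congr 1
    match_scalars <;> field_simp <;> ring
  refine ⟨?_, ?_⟩
  · rw [hv, ha, ← norm_pos_iff, norm_cross3_of_orthogonal _ ht htb]
    have := norm_pos_iff.mpr hb
    positivity
  · rw [osculatingCircleGen_eq _ s₀ hl ht htb hb hv ha,
      image_inv3_curvatureCircle r (hx s₀) (harc s₀) hTA hA hPosc]
end
end

section
/- Let f : ℝ → ℝ³ be a C^∞ embedding of period L parametrized by arc length with curvature κ(s) = |f''(s)| > 0 for all s. Let P : [0,1] → ℝ³ be a continuous path such that for every t ∈ [0,1], P(t) is not contained in the curvature tube of f (in particular P(t) ∉ f([0,L])), and let r₀, r₁ > 0. Assume that for each t the inverted curve I_{P(t),1}∘f has nowhere vanishing curvature. Then Wr(I_{P(0),r₀}∘f) = Wr(I_{P(1),r₁}∘f). -/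
noncomputable section
open Real

open Set Filter Topology MeasureTheory

lemma dot3_eq_inner (u v : E3) : dot3 u v = inner ℝ u v := by
  simp [dot3, PiLp.inner_apply, Fin.sum_univ_three]
  ring

lemma dot3_self (u : E3) : dot3 u u = ‖u‖ ^ 2 := by
  rw [dot3_eq_inner, real_inner_self_eq_norm_sq]

@[simp] lemma cross3_apply_zero (u v : E3) : cross3 u v 0 = u 1 * v 2 - u 2 * v 1 := rfl

@[simp] lemma cross3_apply_one (u v : E3) : cross3 u v 1 = u 2 * v 0 - u 0 * v 2 := rfl

@[simp] lemma cross3_apply_two (u v : E3) : cross3 u v 2 = u 0 * v 1 - u 1 * v 0 := rfl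

lemma abs_dot3_le (u v : E3) : |dot3 u v| ≤ ‖u‖ * ‖v‖ := by
  rw [dot3_eq_inner]
  exact abs_real_inner_le_norm u v

lemma norm_cross3_le (u v : E3) : ‖cross3 u v‖ ≤ ‖u‖ * ‖v‖ := by
  refine le_of_sq_le_sq ?_ (by positivity)
  have h : ‖cross3 u v‖ ^ 2 = ‖u‖ ^ 2 * ‖v‖ ^ 2 - dot3 u v ^ 2 := by
    simp only [← dot3_self, dot3, cross3_apply_zero, cross3_apply_one, cross3_apply_two]
    ring
  rw [h, mul_pow]
  nlinarith [sq_nonneg (dot3 u v)]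

lemma abs_det3_le (u v w : E3) : |det3 u v w| ≤ ‖u‖ * (‖v‖ * ‖w‖) :=
  (abs_dot3_le _ _).trans (by gcongr; exact norm_cross3_le v w)

@[fun_prop]
lemma Continuous.dot3 {X : Type*} [TopologicalSpace X] {u v : X → E3} (hu : Continuous u)
    (hv : Continuous v) : Continuous fun x => dot3 (u x) (v x) := by
  simp only [dot3_eq_inner]
  exact hu.inner hv

@[fun_prop]
lemma Continuous.cross3 {X : Type*} [TopologicalSpace X] {u v : X → E3} (hu : Continuous u)
    (hv : Continuous v) : Continuous fun x => cross3 (u x) (v x) := by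
  have h (i : Fin 3) : Continuous fun x => u x i := by fun_prop
  have h' (i : Fin 3) : Continuous fun x => v x i := by fun_prop
  refine (PiLp.continuous_toLp 2 _).comp (continuous_pi fun i => ?_)
  fin_cases i <;> simp <;> fun_prop

@[fun_prop]
lemma Continuous.det3 {X : Type*} [TopologicalSpace X] {u v w : X → E3} (hu : Continuous u)
    (hv : Continuous v) (hw : Continuous w) : Continuous fun x => det3 (u x) (v x) (w x) :=
  hu.dot3 (hv.cross3 hw)

lemma HasDerivAt.coord {u : ℝ → E3} {u' : E3} {x : ℝ} (hu : HasDerivAt u u' x) (i : Fin 3) :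
    HasDerivAt (fun y => u y i) (u' i) x :=
  (EuclideanSpace.proj (𝕜 := ℝ) i).hasFDerivAt.comp_hasDerivAt x hu

lemma HasDerivAt.dot3 {u v : ℝ → E3} {u' v' : E3} {x : ℝ} (hu : HasDerivAt u u' x)
    (hv : HasDerivAt v v' x) :
    HasDerivAt (fun y => dot3 (u y) (v y)) (dot3 u' (v x) + dot3 (u x) v') x := by
  simp only [dot3_eq_inner]
  exact (hu.inner ℝ hv).congr_deriv (add_comm _ _)

lemma HasDerivAt.det3 {u v w : ℝ → E3} {u' v' w' : E3} {x : ℝ} (hu : HasDerivAt u u' x)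
    (hv : HasDerivAt v v' x) (hw : HasDerivAt w w' x) :
    HasDerivAt (fun y => det3 (u y) (v y) (w y))
      (det3 u' (v x) (w x) + det3 (u x) v' (w x) + det3 (u x) (v x) w') x := by
  simp only [_root_.det3, _root_.dot3, cross3_apply_zero, cross3_apply_one, cross3_apply_two]
  refine ((((hu.coord 0).mul (((hv.coord 1).mul (hw.coord 2)).sub
    ((hv.coord 2).mul (hw.coord 1)))).add ((hu.coord 1).mul (((hv.coord 2).mul
    (hw.coord 0)).sub ((hv.coord 0).mul (hw.coord 2))))).add ((hu.coord 2).mul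
    (((hv.coord 0).mul (hw.coord 1)).sub ((hv.coord 1).mul (hw.coord 0))))).congr_deriv ?_
  simp
  ring

lemma HasDerivAt.norm_of_ne {u : ℝ → E3} {u' : E3} {x : ℝ} (hu : HasDerivAt u u' x)
    (hx : u x ≠ 0) : HasDerivAt (fun y => ‖u y‖) (_root_.dot3 (u x) u' / ‖u x‖) x := by
  have h := (hu.dot3 hu).sqrt (by rw [dot3_self]; exact pow_ne_zero 2 (norm_ne_zero_iff.2 hx))
  simp only [dot3_self, Real.sqrt_sq (norm_nonneg _)] at h
  convert h using 1
  have : _root_.dot3 u' (u x) = _root_.dot3 (u x) u' := by simp only [_root_.dot3]; ring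
  rw [this]
  ring

/-- The partial derivative in `Y`, in the direction `q`, of `-(D · (a × p)) / |D|`, where
`D = X - Y`. -/
def gaussCorrection (a p q D : E3) : ℝ :=
  dot3 q (cross3 a p) / ‖D‖ - dot3 D (cross3 a p) * dot3 D q / ‖D‖ ^ 3

/-- The infinitesimal special conformal transformation of `ℝ³` determined by `a`. -/
def conformalField (a X : E3) : E3 := (2 * dot3 a X) • X - dot3 X X • a

/-- The differential of `conformalField a` at `X`. -/
def conformalFieldDeriv (a X p : E3) : E3 :=
  (2 * dot3 a p) • X + (2 * dot3 a X) • p - (2 * dot3 X p) • a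

lemma hasDerivAt_gaussCorrection {a X p q : E3} {Y : ℝ → E3} {t : ℝ} (hY : HasDerivAt Y q t)
    (hne : X - Y t ≠ 0) :
    HasDerivAt (fun t => -dot3 (X - Y t) (cross3 a p) / ‖X - Y t‖)
      (gaussCorrection a p q (X - Y t)) t := by
  have hD : HasDerivAt (fun t => X - Y t) (-q) t := hY.const_sub X
  have h0 : ‖X - Y t‖ ≠ 0 := norm_ne_zero_iff.2 hne
  refine (((hD.dot3 (hasDerivAt_const t (cross3 a p))).neg).div (hD.norm_of_ne hne)
    h0).congr_deriv ?_
  have h1 : dot3 (X - Y t) 0 = 0 := by simp [dot3]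
  have h2 (w : E3) : dot3 (-q) w = - dot3 q w := by simp [dot3]; ring
  have h3 (w : E3) : dot3 w (-q) = - dot3 w q := by simp [dot3]; ring
  rw [gaussCorrection, h1, h2, h3]
  simp only [Pi.neg_apply]
  field_simp
  ring

lemma hasDerivAt_gaussIntegrand {a : E3} {X Y p q : ℝ → E3} {ε : ℝ}
    (hX : HasDerivAt X (conformalField a (X ε)) ε)
    (hY : HasDerivAt Y (conformalField a (Y ε)) ε)
    (hp : HasDerivAt p (conformalFieldDeriv a (X ε) (p ε)) ε)
    (hq : HasDerivAt q (conformalFieldDeriv a (Y ε) (q ε)) ε) (hne : X ε - Y ε ≠ 0) :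
    HasDerivAt (fun ε => det3 (p ε) (q ε) (X ε - Y ε) / ‖X ε - Y ε‖ ^ 3)
      (gaussCorrection a (p ε) (q ε) (X ε - Y ε) +
        gaussCorrection a (q ε) (p ε) (Y ε - X ε)) ε := by
  have hD : HasDerivAt (fun ε => X ε - Y ε) _ ε := hX.sub hY
  have h0 : ‖X ε - Y ε‖ ≠ 0 := norm_ne_zero_iff.2 hne
  refine ((hp.det3 hq hD).div ((hD.norm_of_ne hne).pow 3) (pow_ne_zero 3 h0)).congr_deriv ?_
  have hN := dot3_self (X ε - Y ε)
  rw [gaussCorrection, gaussCorrection, norm_sub_rev (Y ε)]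
  simp only [Pi.pow_apply]
  generalize ‖X ε - Y ε‖ = N at *
  have key : (det3 (conformalFieldDeriv a (X ε) (p ε)) (q ε) (X ε - Y ε) +
        det3 (p ε) (conformalFieldDeriv a (Y ε) (q ε)) (X ε - Y ε) +
        det3 (p ε) (q ε) (conformalField a (X ε) - conformalField a (Y ε))) *
          dot3 (X ε - Y ε) (X ε - Y ε) -
      3 * det3 (p ε) (q ε) (X ε - Y ε) *
        dot3 (X ε - Y ε) (conformalField a (X ε) - conformalField a (Y ε)) =
      (-dot3 (X ε - Y ε) (cross3 a (p ε)) * dot3 (X ε - Y ε) (q ε)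
        - dot3 (Y ε - X ε) (cross3 a (q ε)) * dot3 (Y ε - X ε) (p ε)) *
          dot3 (X ε - Y ε) (X ε - Y ε) := by
    simp only [det3, dot3, conformalField, conformalFieldDeriv, cross3_apply_zero,
      cross3_apply_one, cross3_apply_two, PiLp.sub_apply, PiLp.add_apply, PiLp.smul_apply,
      smul_eq_mul]
    ring
  have anti : dot3 (q ε) (cross3 a (p ε)) + dot3 (p ε) (cross3 a (q ε)) = 0 := by
    simp only [dot3, cross3_apply_zero, cross3_apply_one, cross3_apply_two]
    ring
  rw [hN] at key
  field_simp
  push_cast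
  linear_combination N ^ 2 * key - N ^ 6 * anti

lemma continuousOn_gaussCorrection {X : Type*} [TopologicalSpace X] {S : Set X} (a : E3)
    {p q D : X → E3} (hp : Continuous p) (hq : Continuous q) (hD : Continuous D)
    (hne : ∀ x ∈ S, D x ≠ 0) :
    ContinuousOn (fun x => gaussCorrection a (p x) (q x) (D x)) S := by
  have h (x) (hx : x ∈ S) : ‖D x‖ ≠ 0 := norm_ne_zero_iff.2 (hne x hx)
  unfold gaussCorrection
  refine ContinuousOn.sub (ContinuousOn.div ?_ ?_ h)
    (ContinuousOn.div ?_ ?_ fun x hx => pow_ne_zero 3 (h x hx)) <;>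
  exact Continuous.continuousOn (by fun_prop)

/-- A closed `C^{1,1}` curve of period `L` with velocity `g₁`, with quantitative bounds on the
velocity, its Lipschitz constant and the ratio of chord to arc. -/
structure ChordArcCurve (g g₁ : ℝ → E3) (L c M K : ℝ) : Prop where
  period_pos : 0 < L
  chord_pos : 0 < c
  hasDerivAt : ∀ s, HasDerivAt g (g₁ s) s
  periodic : Function.Periodic g L
  bound : ∀ s, ‖g₁ s‖ ≤ M
  lipschitz : ∀ s t, ‖g₁ s - g₁ t‖ ≤ K * |s - t|
  chord : ∀ s t, |s - t| ≤ L / 2 → c * |s - t| ≤ ‖g s - g t‖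

namespace ChordArcCurve

variable {g g₁ : ℝ → E3} {L c M K : ℝ}

lemma bound_nonneg (hg : ChordArcCurve g g₁ L c M K) : 0 ≤ M :=
  (norm_nonneg _).trans (hg.bound 0)

lemma lipschitz_nonneg (hg : ChordArcCurve g g₁ L c M K) : 0 ≤ K := by
  simpa using (norm_nonneg _).trans (hg.lipschitz 1 0)

lemma continuous (hg : ChordArcCurve g g₁ L c M K) : Continuous g :=
  continuous_iff_continuousAt.2 fun s => (hg.hasDerivAt s).continuousAt

lemma continuous_velocity (hg : ChordArcCurve g g₁ L c M K) : Continuous g₁ :=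
  (LipschitzWith.of_dist_le_mul (K := ⟨K, hg.lipschitz_nonneg⟩) fun s t => by
    rw [dist_eq_norm, Real.dist_eq]
    exact hg.lipschitz s t).continuous

lemma periodic_velocity (hg : ChordArcCurve g g₁ L c M K) : Function.Periodic g₁ L := fun s => by
  have h := (hg.hasDerivAt (s + L)).comp_add_const s L
  simp only [hg.periodic _] at h
  exact h.unique (hg.hasDerivAt s)

lemma sub_ne_zero_of_le (hg : ChordArcCurve g g₁ L c M K) {s t : ℝ} (hst : s ≠ t)
    (h : |s - t| ≤ L / 2) : g s - g t ≠ 0 := fun h0 => by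
  have h1 := hg.chord s t h
  rw [h0, norm_zero] at h1
  exact absurd h1 (not_le.2 (mul_pos hg.chord_pos (abs_pos.2 (sub_ne_zero.2 hst))))

lemma sub_ne_zero (hg : ChordArcCurve g g₁ L c M K) {s u : ℝ} (hu : u ∈ Ioo 0 L) :
    g s - g (s + u) ≠ 0 := by
  obtain ⟨h0, h1⟩ := hu
  rcases le_total u (L / 2) with h | h
  · refine hg.sub_ne_zero_of_le (by linarith) ?_
    rw [abs_le]
    constructor <;> linarith
  · rw [show s + u = s + u - L + L by ring, hg.periodic]
    refine hg.sub_ne_zero_of_le (by linarith) ?_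
    rw [abs_le]
    constructor <;> linarith

lemma norm_taylor_le (hg : ChordArcCurve g g₁ L c M K) (s t : ℝ) :
    ‖g s - g t - (s - t) • g₁ s‖ ≤ K * |s - t| ^ 2 := by
  have h := (convex_uIcc s t).norm_image_sub_le_of_norm_hasDerivWithin_le
    (f := fun τ => g τ - (τ - s) • g₁ s) (f' := fun τ => g₁ τ - g₁ s) (C := K * |s - t|)
    (fun τ _ => ?_) (fun τ hτ => ?_) right_mem_uIcc left_mem_uIcc
  · rw [Real.norm_eq_abs] at h
    convert h using 1
    · congr 1
      module
    · ring
  · have := (((hasDerivAt_id τ).sub_const s).smul_const (g₁ s))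
    rw [one_smul] at this
    exact ((hg.hasDerivAt τ).sub this).hasDerivWithinAt
  · refine (hg.lipschitz τ s).trans ?_
    rw [abs_sub_comm s t]
    exact mul_le_mul_of_nonneg_left (abs_sub_left_of_mem_uIcc hτ) hg.lipschitz_nonneg

lemma abs_boundary_le (hg : ChordArcCurve g g₁ L c M K) (a : E3) {s t : ℝ} (hst : s ≠ t)
    (h : |s - t| ≤ L / 2) :
    |-dot3 (g s - g t) (cross3 a (g₁ s)) / ‖g s - g t‖| ≤ K * (‖a‖ * M) / c * |s - t| := by
  have hpos : 0 < |s - t| := abs_pos.2 (_root_.sub_ne_zero.2 hst)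
  have hK := hg.lipschitz_nonneg
  have hM := hg.bound_nonneg
  have hc := hg.chord_pos
  have e : dot3 (g s - g t) (cross3 a (g₁ s)) =
      dot3 (g s - g t - (s - t) • g₁ s) (cross3 a (g₁ s)) := by
    simp only [dot3, cross3_apply_zero, cross3_apply_one, cross3_apply_two, PiLp.sub_apply,
      PiLp.smul_apply, smul_eq_mul]
    ring
  rw [abs_div, abs_neg, abs_norm, e]
  calc _ ≤ K * |s - t| ^ 2 * (‖a‖ * M) / (c * |s - t|) := by
        gcongr
        · refine (abs_dot3_le _ _).trans ?_
          gcongr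
          · exact hg.norm_taylor_le s t
          · refine (norm_cross3_le _ _).trans ?_
            gcongr
            exact hg.bound s
        · exact hg.chord s t h
    _ = _ := by field_simp

lemma abs_integrand_le_of_le (hg : ChordArcCurve g g₁ L c M K) {s t : ℝ}
    (h : |s - t| ≤ L / 2) :
    |det3 (g₁ s) (g₁ t) (g s - g t) / ‖g s - g t‖ ^ 3| ≤ M * K ^ 2 / c ^ 3 := by
  have hK := hg.lipschitz_nonneg
  have hM := hg.bound_nonneg
  have hc := hg.chord_pos
  rcases eq_or_ne s t with rfl | hst
  · simp only [sub_self, norm_zero]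
    norm_num
    positivity
  have hpos : 0 < |s - t| := abs_pos.2 (_root_.sub_ne_zero.2 hst)
  have e : det3 (g₁ s) (g₁ t) (g s - g t) =
      det3 (g₁ s) (g₁ t - g₁ s) (g s - g t - (s - t) • g₁ s) := by
    simp only [det3, dot3, cross3_apply_zero, cross3_apply_one, cross3_apply_two, PiLp.sub_apply,
      PiLp.smul_apply, smul_eq_mul]
    ring
  rw [abs_div, abs_pow, abs_norm, e]
  calc _ ≤ M * (K * |s - t| * (K * |s - t| ^ 2)) / (c * |s - t|) ^ 3 := by
        gcongr
        · refine (abs_det3_le _ _ _).trans ?_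
          gcongr
          · exact hg.bound s
          · rw [norm_sub_rev]
            exact hg.lipschitz s t
          · exact hg.norm_taylor_le s t
        · exact hg.chord s t h
    _ = _ := by field_simp

lemma abs_integrand_le (hg : ChordArcCurve g g₁ L c M K) {s u : ℝ} (hu : u ∈ Icc 0 L) :
    |det3 (g₁ s) (g₁ (s + u)) (g s - g (s + u)) / ‖g s - g (s + u)‖ ^ 3| ≤
      M * K ^ 2 / c ^ 3 := by
  obtain ⟨h0, h1⟩ := hu
  rcases le_total u (L / 2) with h | h
  · refine hg.abs_integrand_le_of_le ?_
    rw [abs_le]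
    constructor <;> linarith
  · rw [show s + u = s + u - L + L by ring, hg.periodic, hg.periodic_velocity]
    refine hg.abs_integrand_le_of_le ?_
    rw [abs_le]
    constructor <;> linarith

lemma abs_integral_gaussCorrection_le (hg : ChordArcCurve g g₁ L c M K) (a : E3) {δ : ℝ}
    (hδ : δ ∈ Ioc 0 (L / 2)) (s : ℝ) :
    |∫ u in δ..(L - δ), gaussCorrection a (g₁ s) (g₁ (s + u)) (g s - g (s + u))| ≤
      2 * (K * (‖a‖ * M) / c) * δ := by
  obtain ⟨h0, h1⟩ := hδ
  have hsub : uIcc δ (L - δ) ⊆ Ioo 0 L := by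
    rw [uIcc_of_le (by linarith)]
    exact fun x hx => ⟨by linarith [hx.1], by linarith [hx.2]⟩
  have hcont := hg.continuous
  have hcont₁ := hg.continuous_velocity
  rw [intervalIntegral.integral_eq_sub_of_hasDerivAt
    (f := fun u => -dot3 (g s - g (s + u)) (cross3 a (g₁ s)) / ‖g s - g (s + u)‖)
    (fun u hu => hasDerivAt_gaussCorrection ((hg.hasDerivAt (s + u)).comp_const_add s u)
      (hg.sub_ne_zero (hsub hu)))
    (ContinuousOn.intervalIntegrable (continuousOn_gaussCorrection a (by fun_prop) (by fun_prop)
      (by fun_prop) fun u hu => hg.sub_ne_zero (hsub hu)))]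
  have e : s + (L - δ) = s - δ + L := by ring
  rw [e, hg.periodic]
  have b1 := hg.abs_boundary_le a (s := s) (t := s - δ) (by linarith) (by
    rw [abs_le]; constructor <;> linarith)
  have b2 := hg.abs_boundary_le a (s := s) (t := s + δ) (by linarith) (by
    rw [abs_le]; constructor <;> linarith)
  rw [show s - (s - δ) = δ by ring, abs_of_pos h0] at b1
  rw [show s - (s + δ) = -δ by ring, abs_neg, abs_of_pos h0] at b2
  refine (abs_sub _ _).trans ?_
  linarith

end ChordArcCurve

/-- A doubly periodic function has the same integral over the strips on either side of the
diagonal. -/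
lemma integral_strip_symm {Q : ℝ → ℝ → ℝ} {L δ : ℝ} (h₁ : ∀ t, Function.Periodic (fun s => Q s t) L)
    (h₂ : ∀ s, Function.Periodic (Q s) L) (hδ : δ ≤ L - δ) (hL : 0 ≤ L)
    (hQ : ContinuousOn (fun z : ℝ × ℝ => Q (z.1 + z.2) z.1) (Icc 0 L ×ˢ Icc δ (L - δ)))
    (hQ' : ContinuousOn (fun z : ℝ × ℝ => Q z.1 (z.1 + z.2)) (Icc 0 L ×ˢ Icc δ (L - δ))) :
    ∫ s in (0:ℝ)..L, ∫ u in δ..(L - δ), Q (s + u) s =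
      ∫ s in (0:ℝ)..L, ∫ u in δ..(L - δ), Q s (s + u) := by
  have hint {F : ℝ → ℝ → ℝ}
      (hF : ContinuousOn (fun z : ℝ × ℝ => F z.1 z.2) (Icc 0 L ×ˢ Icc δ (L - δ))) :
      IntegrableOn (Function.uncurry F) (uIoc 0 L ×ˢ uIoc δ (L - δ)) := by
    rw [uIoc_of_le hL, uIoc_of_le hδ]
    exact (hF.integrableOn_compact (isCompact_Icc.prod isCompact_Icc)).mono_set
      (prod_mono Ioc_subset_Icc_self Ioc_subset_Icc_self)
  rw [intervalIntegral_intervalIntegral_swap (hint hQ),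
    intervalIntegral_intervalIntegral_swap (hint hQ')]
  have key (u : ℝ) : ∫ s in (0:ℝ)..L, Q (s + (L - u)) s = ∫ s in (0:ℝ)..L, Q s (s + u) := by
    have hper : Function.Periodic (fun s => Q s (s + u)) L := fun s => by
      change Q (s + L) (s + L + u) = _
      rw [show s + L + u = s + u + L by ring, h₂]
      exact h₁ _ s
    have := intervalIntegral.integral_comp_add_right (a := 0) (b := L)
      (fun s => Q s (s + u)) (L - u)
    rw [zero_add, add_comm L, hper.intervalIntegral_add_eq _ 0, zero_add] at this
    rw [← this]
    refine intervalIntegral.integral_congr fun s _ => ?_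
    rw [show s + (L - u) + u = s + L by ring, h₂]
  have := intervalIntegral.integral_comp_sub_left (a := δ) (b := L - δ)
    (fun u => ∫ s in (0:ℝ)..L, Q (s + u) s) L
  simp only [key] at this
  rw [sub_sub_cancel] at this
  exact this.symm

/-- The integrand of the Gauss integral of a curve `g` with velocity `g₁`, at the pair of
parameters `(s, s + u)`. -/
def gaussIntegrand (g g₁ : ℝ → E3) (z : ℝ × ℝ) : ℝ :=
  det3 (g₁ z.1) (g₁ (z.1 + z.2)) (g z.1 - g (z.1 + z.2)) / ‖g z.1 - g (z.1 + z.2)‖ ^ 3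

namespace ChordArcCurve

variable {g g₁ : ℝ → E3} {L c M K : ℝ}

lemma continuousOn_gaussIntegrand (hg : ChordArcCurve g g₁ L c M K) :
    ContinuousOn (gaussIntegrand g g₁) (Ioc 0 L ×ˢ Ioo 0 L) := by
  have hcont := hg.continuous
  have hcont₁ := hg.continuous_velocity
  unfold gaussIntegrand
  refine ContinuousOn.div (Continuous.continuousOn (by fun_prop))
    (Continuous.continuousOn (by fun_prop)) fun z hz => ?_
  exact pow_ne_zero 3 (norm_ne_zero_iff.2 (hg.sub_ne_zero hz.2))

lemma integrableOn_gaussIntegrand (hg : ChordArcCurve g g₁ L c M K) :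
    IntegrableOn (gaussIntegrand g g₁) (Ioc 0 L ×ˢ Ioo 0 L) := by
  have hmeas : MeasurableSet (Ioc 0 L ×ˢ Ioo 0 L) := measurableSet_Ioc.prod measurableSet_Ioo
  refine ⟨hg.continuousOn_gaussIntegrand.aestronglyMeasurable hmeas,
    .restrict_of_bounded (C := M * K ^ 2 / c ^ 3) (lt_top_iff_ne_top.2 ?_) ?_⟩
  · rw [Measure.volume_eq_prod, Measure.prod_prod]
    simp [ENNReal.mul_eq_top]
  · refine (ae_restrict_iff' hmeas).2 (ae_of_all _ fun z hz => ?_)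
    exact hg.abs_integrand_le (Ioo_subset_Icc_self hz.2)

lemma writhe_eq (hg : ChordArcCurve g g₁ L c M K) :
    writhe g L = 1 / (4 * π) * ∫ z in Ioc 0 L ×ˢ Ioo 0 L, gaussIntegrand g g₁ z := by
  have hint := hg.integrableOn_gaussIntegrand
  rw [Measure.volume_eq_prod] at hint ⊢
  rw [writhe, setIntegral_prod _ hint, intervalIntegral.integral_of_le hg.period_pos.le]
  congr 1
  refine setIntegral_congr_fun measurableSet_Ioc fun s _ => ?_
  have hderiv : deriv g = g₁ := funext fun s => (hg.hasDerivAt s).deriv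
  simp only [hderiv]
  rw [← integral_Ioc_eq_integral_Ioo, ← intervalIntegral.integral_of_le hg.period_pos.le]
  have hper : Function.Periodic
      (fun t => det3 (g₁ s) (g₁ t) (g s - g t) / ‖g s - g t‖ ^ 3) L := fun t => by
    simp only [hg.periodic t, hg.periodic_velocity t]
  have h1 := hper.intervalIntegral_add_eq 0 s
  have h2 := intervalIntegral.integral_comp_add_left (a := 0) (b := L)
    (fun t => det3 (g₁ s) (g₁ t) (g s - g t) / ‖g s - g t‖ ^ 3) s
  rw [zero_add] at h1
  rw [add_zero] at h2
  exact h1.trans h2.symm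

lemma tendsto_setIntegral_gaussIntegrand (hg : ChordArcCurve g g₁ L c M K) :
    Tendsto (fun n : ℕ => ∫ z in Ioc 0 L ×ˢ Icc (L / 2 / ((n : ℝ) + 1)) (L - L / 2 / ((n : ℝ) + 1)),
      gaussIntegrand g g₁ z) atTop
      (𝓝 (∫ z in Ioc 0 L ×ˢ Ioo 0 L, gaussIntegrand g g₁ z)) := by
  have hL := hg.period_pos
  have hunion : ⋃ n : ℕ, Ioc 0 L ×ˢ Icc (L / 2 / ((n : ℝ) + 1)) (L - L / 2 / ((n : ℝ) + 1)) =
      Ioc 0 L ×ˢ Ioo 0 L := by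
    rw [← prod_iUnion]
    congr 1
    refine Subset.antisymm (iUnion_subset fun n u hu => ?_) fun u hu => ?_
    · have : 0 < L / 2 / ((n : ℝ) + 1) := by positivity
      exact ⟨by linarith [hu.1], by linarith [hu.2]⟩
    · have hlim : Tendsto (fun n : ℕ => L / 2 / ((n : ℝ) + 1)) atTop (𝓝 0) := by
        simpa [div_eq_mul_inv] using (tendsto_one_div_add_atTop_nhds_zero_nat (𝕜 := ℝ)).const_mul
          (L / 2)
      obtain ⟨n, hn⟩ := (hlim.eventually (gt_mem_nhds
        (lt_min hu.1 (sub_pos.2 hu.2)))).exists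
      obtain ⟨h1, h2⟩ := lt_min_iff.1 hn
      exact mem_iUnion.2 ⟨n, h1.le, by linarith⟩
  have := tendsto_setIntegral_of_monotone (f := gaussIntegrand g g₁) (μ := volume)
    (s := fun n : ℕ => Ioc 0 L ×ˢ Icc (L / 2 / ((n : ℝ) + 1)) (L - L / 2 / ((n : ℝ) + 1)))
    (fun n => measurableSet_Ioc.prod measurableSet_Icc) (fun m n hmn => ?_)
    (by rw [hunion]; exact hg.integrableOn_gaussIntegrand)
  · rwa [hunion] at this
  · have : L / 2 / ((n : ℝ) + 1) ≤ L / 2 / ((m : ℝ) + 1) := by gcongr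
    exact prod_mono le_rfl (Icc_subset_Icc this (by linarith))

end ChordArcCurve

/-- The writhe does not change along a curve of closed curves that moves by infinitesimal special
conformal transformations. -/
lemma writhe_eq_of_conformalField {h h₁ : ℝ → ℝ → E3} {L c M K : ℝ} {a : E3}
    (hcont : Continuous (Function.uncurry h)) (hcont₁ : Continuous (Function.uncurry h₁))
    (hg : ∀ ε, ChordArcCurve (h ε) (h₁ ε) L c M K)
    (hd : ∀ ε ∈ Ioo (0:ℝ) 1, ∀ s,
      HasDerivAt (fun ε => h ε s) (conformalField a (h ε s)) ε)
    (hd₁ : ∀ ε ∈ Ioo (0:ℝ) 1, ∀ s,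
      HasDerivAt (fun ε => h₁ ε s) (conformalFieldDeriv a (h ε s) (h₁ ε s)) ε) :
    writhe (h 0) L = writhe (h 1) L := by
  have hL := (hg 0).period_pos
  have hc : Continuous fun z : ℝ × ℝ => h z.1 z.2 := hcont
  have hc₁ : Continuous fun z : ℝ × ℝ => h₁ z.1 z.2 := hcont₁
  have hcomp {X : Type} [TopologicalSpace X] {u v : X → ℝ} (hu : Continuous u)
      (hv : Continuous v) : Continuous fun x => h (u x) (v x) := hc.comp (hu.prodMk hv)
  have hcomp₁ {X : Type} [TopologicalSpace X] {u v : X → ℝ} (hu : Continuous u)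
      (hv : Continuous v) : Continuous fun x => h₁ (u x) (v x) := hc₁.comp (hu.prodMk hv)
  let Q (ε s t : ℝ) : ℝ := gaussCorrection a (h₁ ε s) (h₁ ε t) (h ε s - h ε t)
  have hne (ε : ℝ) {s u : ℝ} (hu : u ∈ Ioo 0 L) : h ε s - h ε (s + u) ≠ 0 := (hg ε).sub_ne_zero hu
  have hne' (ε : ℝ) {s u : ℝ} (hu : u ∈ Ioo 0 L) : h ε (s + u) - h ε s ≠ 0 := by
    rw [← neg_sub, neg_ne_zero]
    exact hne ε hu
  have hQ : ContinuousOn (fun x : ℝ × ℝ × ℝ => Q x.1 x.2.1 (x.2.1 + x.2.2))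
      {x | x.2.2 ∈ Ioo 0 L} :=
    continuousOn_gaussCorrection a (hcomp₁ (by fun_prop) (by fun_prop))
      (hcomp₁ (by fun_prop) (by fun_prop))
      ((hcomp (by fun_prop) (by fun_prop)).sub (hcomp (by fun_prop) (by fun_prop)))
      fun x hx => hne _ hx
  have hQ' : ContinuousOn (fun x : ℝ × ℝ × ℝ => Q x.1 (x.2.1 + x.2.2) x.2.1)
      {x | x.2.2 ∈ Ioo 0 L} :=
    continuousOn_gaussCorrection a (hcomp₁ (by fun_prop) (by fun_prop))
      (hcomp₁ (by fun_prop) (by fun_prop))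
      ((hcomp (by fun_prop) (by fun_prop)).sub (hcomp (by fun_prop) (by fun_prop)))
      fun x hx => hne' _ hx
  let G (ε : ℝ) (z : ℝ × ℝ) : ℝ := Q ε z.1 (z.1 + z.2) + Q ε (z.1 + z.2) z.1
  have hG : ContinuousOn (fun x : ℝ × ℝ × ℝ => G x.1 x.2) {x | x.2.2 ∈ Ioo 0 L} := hQ.add hQ'
  have hderiv (z : ℝ × ℝ) (hz : z.2 ∈ Ioo 0 L) :
      gaussIntegrand (h 1) (h₁ 1) z - gaussIntegrand (h 0) (h₁ 0) z = ∫ ε in (0:ℝ)..1, G ε z := by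
    have hcG : ContinuousOn (fun ε => G ε z) (uIcc 0 1) :=
      hG.comp (f := fun ε : ℝ => (ε, z)) (by fun_prop) fun ε _ => hz
    refine (intervalIntegral.integral_eq_sub_of_hasDerivAt_of_le zero_le_one ?_
      (f := fun ε => gaussIntegrand (h ε) (h₁ ε) z) (fun ε hε => ?_)
      hcG.intervalIntegrable).symm
    · unfold gaussIntegrand
      refine Continuous.continuousOn (Continuous.div ?_ ?_ fun ε =>
        pow_ne_zero 3 (norm_ne_zero_iff.2 (hne ε hz)))
      · exact (hcomp₁ (by fun_prop) (by fun_prop)).det3 (hcomp₁ (by fun_prop) (by fun_prop))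
          ((hcomp (by fun_prop) (by fun_prop)).sub (hcomp (by fun_prop) (by fun_prop)))
      · exact (((hcomp (by fun_prop) (by fun_prop)).sub
          (hcomp (by fun_prop) (by fun_prop))).norm).pow 3
    · exact hasDerivAt_gaussIntegrand (hd ε hε _) (hd ε hε _) (hd₁ ε hε _) (hd₁ ε hε _)
        (hne ε hz)
  have hbound {δ : ℝ} (hδ : δ ∈ Ioc 0 (L / 2)) :
      |(∫ z in Ioc 0 L ×ˢ Icc δ (L - δ), gaussIntegrand (h 1) (h₁ 1) z) -
        ∫ z in Ioc 0 L ×ˢ Icc δ (L - δ), gaussIntegrand (h 0) (h₁ 0) z| ≤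
        2 * (2 * (K * (‖a‖ * M) / c) * δ * L) := by
    have hδL : δ ≤ L - δ := by linarith [hδ.2]
    have hsub : Icc δ (L - δ) ⊆ Ioo 0 L := fun u hu =>
      ⟨hδ.1.trans_le hu.1, by linarith [hu.2, hδ.1]⟩
    have hsub' : Ioc 0 L ×ˢ Icc δ (L - δ) ⊆ Ioc 0 L ×ˢ Ioo 0 L := prod_mono le_rfl hsub
    have hmeas : MeasurableSet (Ioc 0 L ×ˢ Icc δ (L - δ)) :=
      measurableSet_Ioc.prod measurableSet_Icc
    rw [← integral_sub ((hg 1).integrableOn_gaussIntegrand.mono_set hsub')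
      ((hg 0).integrableOn_gaussIntegrand.mono_set hsub'),
      setIntegral_congr_fun hmeas fun z hz => hderiv z (hsub hz.2)]
    rw [← intervalIntegral_integral_swap]
    swap
    · rw [Measure.prod_restrict, ← Measure.volume_eq_prod, ← IntegrableOn]
      refine (ContinuousOn.integrableOn_compact
        (isCompact_uIcc.prod (isCompact_Icc.prod isCompact_Icc)) (hG.mono ?_)).mono_set
        (prod_mono uIoc_subset_uIcc (prod_mono Ioc_subset_Icc_self le_rfl))
      exact fun x hx => hsub hx.2.2
    suffices hfix : ∀ ε, ‖∫ z in Ioc 0 L ×ˢ Icc δ (L - δ), G ε z‖ ≤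
        2 * (2 * (K * (‖a‖ * M) / c) * δ * L) by
      simpa using intervalIntegral.norm_integral_le_of_norm_le_const (a := (0:ℝ)) (b := 1)
        fun ε _ => hfix ε
    intro ε
    have hcQ : ContinuousOn (fun z : ℝ × ℝ => Q ε z.1 (z.1 + z.2)) (Icc 0 L ×ˢ Icc δ (L - δ)) :=
      hQ.comp (f := fun z : ℝ × ℝ => (ε, z)) (by fun_prop) fun z hz => hsub hz.2
    have hcQ' : ContinuousOn (fun z : ℝ × ℝ => Q ε (z.1 + z.2) z.1) (Icc 0 L ×ˢ Icc δ (L - δ)) :=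
      hQ'.comp (f := fun z : ℝ × ℝ => (ε, z)) (by fun_prop) fun z hz => hsub hz.2
    have hint {F : ℝ × ℝ → ℝ} (hF : ContinuousOn F (Icc 0 L ×ˢ Icc δ (L - δ))) :
        IntegrableOn F (Ioc 0 L ×ˢ Icc δ (L - δ)) :=
      (hF.integrableOn_compact (isCompact_Icc.prod isCompact_Icc)).mono_set
        (prod_mono Ioc_subset_Icc_self le_rfl)
    have hiter {F : ℝ × ℝ → ℝ} (hF : ContinuousOn F (Icc 0 L ×ˢ Icc δ (L - δ))) :
        ∫ z in Ioc 0 L ×ˢ Icc δ (L - δ), F z =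
          ∫ s in (0:ℝ)..L, ∫ u in δ..(L - δ), F (s, u) := by
      have := hint hF
      rw [Measure.volume_eq_prod] at this ⊢
      rw [setIntegral_prod _ this, intervalIntegral.integral_of_le hL.le]
      simp only [intervalIntegral.integral_of_le hδL, integral_Icc_eq_integral_Ioc]
    have hsymm := integral_strip_symm (Q := Q ε)
      (fun t s => by simp only [Q, (hg ε).periodic s, (hg ε).periodic_velocity s])
      (fun s t => by simp only [Q, (hg ε).periodic t, (hg ε).periodic_velocity t])
      hδL hL.le hcQ' hcQ
    rw [integral_add (hint hcQ) (hint hcQ'), hiter hcQ, hiter hcQ', hsymm, ← two_mul, norm_mul,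
      Real.norm_ofNat]
    gcongr
    refine (intervalIntegral.norm_integral_le_of_norm_le_const fun s _ =>
      (hg ε).abs_integral_gaussCorrection_le a hδ s).trans ?_
    rw [sub_zero, abs_of_pos hL]
  have hlim := ((hg 1).tendsto_setIntegral_gaussIntegrand.sub
    (hg 0).tendsto_setIntegral_gaussIntegrand).abs
  have hzero : Tendsto (fun n : ℕ => 2 * (2 * (K * (‖a‖ * M) / c) * (L / 2 / ((n : ℝ) + 1)) * L))
      atTop (𝓝 0) := by
    have := (tendsto_one_div_add_atTop_nhds_zero_nat (𝕜 := ℝ)).const_mul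
      (2 * (2 * (K * (‖a‖ * M) / c) * (L / 2) * L))
    rw [mul_zero] at this
    refine this.congr fun n => ?_
    ring
  have hle := le_of_tendsto_of_tendsto' hlim hzero fun n => hbound ⟨by positivity, by
    refine div_le_self (by positivity) ?_
    linarith [n.cast_nonneg (α := ℝ)]⟩
  rw [(hg 0).writhe_eq, (hg 1).writhe_eq]
  congr 1
  exact (sub_eq_zero.1 (abs_nonpos_iff.1 hle)).symm

/-- The inversion in the unit sphere centered at the origin. -/
def unitInv (x : E3) : E3 := (dot3 x x)⁻¹ • x

/-- The differential of `unitInv` at `x`, applied to `p`. -/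
def unitInvDeriv (x p : E3) : E3 :=
  (dot3 x x)⁻¹ • p - (2 * dot3 x p * (dot3 x x)⁻¹ ^ 2) • x

/-- The differential of `unitInvDeriv` at `(x, p)`, applied to `(v, w)`. -/
def unitInvSecondDeriv (x p v w : E3) : E3 :=
  (dot3 x x)⁻¹ • w - (2 * dot3 x v * (dot3 x x)⁻¹ ^ 2) • p -
    (2 * (dot3 v p + dot3 x w) * (dot3 x x)⁻¹ ^ 2 -
      8 * dot3 x p * dot3 x v * (dot3 x x)⁻¹ ^ 3) • x -
    (2 * dot3 x p * (dot3 x x)⁻¹ ^ 2) • v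

lemma dot3_self_ne_zero {x : E3} (hx : x ≠ 0) : dot3 x x ≠ 0 := by
  rw [dot3_self]
  exact pow_ne_zero 2 (norm_ne_zero_iff.2 hx)

lemma dot3_comm (u v : E3) : dot3 u v = dot3 v u := by
  simp only [dot3]
  ring

lemma hasDerivAt_unitInv {x : ℝ → E3} {p : E3} {s : ℝ} (hx : HasDerivAt x p s) (h0 : x s ≠ 0) :
    HasDerivAt (fun s => unitInv (x s)) (unitInvDeriv (x s) p) s := by
  have hN := dot3_self_ne_zero h0
  refine (((hx.dot3 hx).fun_inv hN).smul hx).congr_deriv ?_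
  rw [unitInvDeriv, dot3_comm p, sub_eq_add_neg, ← neg_smul]
  congr 2
  field_simp
  ring

lemma hasDerivAt_unitInvDeriv {x p : ℝ → E3} {v w : E3} {s : ℝ} (hx : HasDerivAt x v s)
    (hp : HasDerivAt p w s) (h0 : x s ≠ 0) :
    HasDerivAt (fun s => unitInvDeriv (x s) (p s)) (unitInvSecondDeriv (x s) (p s) v w) s := by
  have hN := dot3_self_ne_zero h0
  have hinv := (hx.dot3 hx).fun_inv hN
  refine ((hinv.smul hp).sub ((((hx.dot3 hp).const_mul 2).mul (hinv.fun_pow 2)).smul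
    hx)).congr_deriv ?_
  rw [unitInvSecondDeriv, dot3_comm v (x s)]
  simp only [Pi.mul_apply, Nat.reduceSub, Nat.cast_ofNat, pow_one]
  match_scalars <;> field_simp <;> ring

lemma unitInvDeriv_neg {x : E3} (hx : x ≠ 0) (a : E3) :
    unitInvDeriv x (-a) = conformalField a (unitInv x) := by
  have hN := dot3_self_ne_zero hx
  have e1 : dot3 x (-a) = -dot3 a x := by simp only [dot3, PiLp.neg_apply]; ring
  have e2 (k : ℝ) : dot3 a (k • x) = k * dot3 a x := by
    simp only [dot3, PiLp.smul_apply, smul_eq_mul]; ring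
  have e3 (k : ℝ) : dot3 (k • x) (k • x) = k ^ 2 * dot3 x x := by
    simp only [dot3, PiLp.smul_apply, smul_eq_mul]; ring
  rw [unitInvDeriv, conformalField, unitInv, e1, e2, e3]
  match_scalars <;> field_simp

lemma unitInvSecondDeriv_neg {x : E3} (hx : x ≠ 0) (a p : E3) :
    unitInvSecondDeriv x p (-a) 0 = conformalFieldDeriv a (unitInv x) (unitInvDeriv x p) := by
  have hN := dot3_self_ne_zero hx
  have e1 (u : E3) : dot3 u (-a) = -dot3 a u := by simp only [dot3, PiLp.neg_apply]; ring
  have e1' (u : E3) : dot3 (-a) u = -dot3 a u := by simp only [dot3, PiLp.neg_apply]; ring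
  have e2 (k : ℝ) : dot3 a (k • x) = k * dot3 a x := by
    simp only [dot3, PiLp.smul_apply, smul_eq_mul]; ring
  have e3 (u : E3) (k l : ℝ) : dot3 u (k • p - l • x) = k * dot3 u p - l * dot3 u x := by
    simp only [dot3, PiLp.sub_apply, PiLp.smul_apply, smul_eq_mul]; ring
  have e4 (u : E3) (k : ℝ) : dot3 (k • x) u = k * dot3 x u := by
    simp only [dot3, PiLp.smul_apply, smul_eq_mul]; ring
  have e5 : dot3 x 0 = 0 := by simp [dot3]
  simp only [unitInvSecondDeriv, conformalFieldDeriv, unitInvDeriv, unitInv, e1, e1', e2, e3, e4,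
    e5]
  match_scalars <;> field_simp <;> ring

lemma norm_unitInv_sub {x y : E3} (hx : x ≠ 0) (hy : y ≠ 0) :
    ‖unitInv x - unitInv y‖ = ‖x - y‖ / (‖x‖ * ‖y‖) := by
  have h := dist_div_norm_sq_smul hx hy 1
  have e (z : E3) : (1 / ‖z‖) ^ 2 • z = unitInv z := by
    rw [unitInv, dot3_self, one_div, inv_pow]
  rw [e, e, dist_eq_norm, dist_eq_norm] at h
  rw [h]
  ring

lemma writhe_const_add_smul (g : ℝ → E3) (L : ℝ) (P : E3) {k : ℝ} (hk : 0 < k) :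
    writhe (fun s => P + k • g s) L = writhe g L := by
  have hd (s : ℝ) : deriv (fun s => P + k • g s) s = k • deriv g s := by
    rw [deriv_const_add, deriv_fun_const_smul_field]
  unfold writhe
  congr 1
  refine intervalIntegral.integral_congr fun s _ => intervalIntegral.integral_congr fun t _ => ?_
  simp only [hd]
  have e : P + k • g s - (P + k • g t) = k • (g s - g t) := by module
  have e' (u v w : E3) : det3 (k • u) (k • v) (k • w) = k ^ 3 * det3 u v w := by
    simp only [det3, dot3, cross3_apply_zero, cross3_apply_one, cross3_apply_two,
      PiLp.smul_apply, smul_eq_mul]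
    ring
  rw [e, e', norm_smul, Real.norm_of_nonneg hk.le, mul_pow, mul_div_mul_left _ _ (by positivity)]

lemma writhe_inv3 (f : ℝ → E3) (L : ℝ) (P : E3) {r : ℝ} (hr : 0 < r) :
    writhe (fun s => inv3 P r (f s)) L = writhe (fun s => unitInv (f s - P)) L := by
  rw [← writhe_const_add_smul (fun s => unitInv (f s - P)) L P (pow_pos hr 2)]
  congr 1
  funext s
  rw [inv3, unitInv, dot3_self, smul_smul, div_eq_mul_inv]

lemma exists_norm_le_of_clamp {k : ℝ → ℝ → E3} {L : ℝ} (hL : 0 < L)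
    (hk : Continuous fun z : ℝ × ℝ => k z.1 z.2) (hper : ∀ ε, Function.Periodic (k ε) L)
    (hclamp : ∀ ε s, k (projIcc 0 1 zero_le_one ε) s = k ε s) : ∃ M, ∀ ε s, ‖k ε s‖ ≤ M := by
  obtain ⟨M, hM⟩ := ((isCompact_Icc (a := (0:ℝ)) (b := 1)).prod
    (isCompact_Icc (a := (0:ℝ)) (b := L))).exists_bound_of_continuousOn hk.continuousOn
  refine ⟨M, fun ε s => ?_⟩
  obtain ⟨s', hs', he⟩ := (hper ε).exists_mem_Ico₀ hL s
  rw [he, ← hclamp]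
  exact hM (_, s') ⟨Subtype.coe_prop _, Ico_subset_Icc_self hs'⟩

lemma exists_chordArcCurve {f : ℝ → E3} {L : ℝ} (hL : 0 < L) (hf : ContDiff ℝ (⊤ : ℕ∞) f)
    (hper : Function.Periodic f L) (hreg : ∀ s, deriv f s ≠ 0) (hinj : InjOn f (Ico 0 L)) :
    ∃ c M K, ChordArcCurve f (deriv f) L c M K := by
  have hfd : Differentiable ℝ f := hf.differentiable (by simp)
  have hf₁ : ContDiff ℝ (⊤ : ℕ∞) (deriv f) := hf.deriv'
  have hf₁d : Differentiable ℝ (deriv f) := hf₁.differentiable (by simp)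
  have hf₂c : Continuous (deriv (deriv f)) := hf₁.continuous_deriv (by simp)
  have hf₁c : Continuous (deriv f) := hf₁.continuous
  have hper₁ : Function.Periodic (deriv f) L := fun s => by
    rw [← deriv_comp_add_const, show (fun x => f (x + L)) = f from funext hper]
  have hper₂ : Function.Periodic (deriv (deriv f)) L := fun s => by
    rw [← deriv_comp_add_const, show (fun x => deriv f (x + L)) = deriv f from funext hper₁]
  obtain ⟨M, hM⟩ := exists_norm_le_of_clamp hL (k := fun _ => deriv f) (by fun_prop)
    (fun _ => hper₁) fun _ _ => rfl
  obtain ⟨K, hK⟩ := exists_norm_le_of_clamp hL (k := fun _ => deriv (deriv f)) (by fun_prop)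
    (fun _ => hper₂) fun _ _ => rfl
  let q (z : ℝ × ℝ) : E3 := ∫ θ in (0:ℝ)..1, deriv f (z.1 + z.2 * θ)
  have hq : Continuous q :=
    intervalIntegral.continuous_parametric_intervalIntegral_of_continuous' (by fun_prop) _ _
  have hqf (s u : ℝ) : u • q (s, u) = f (s + u) - f s := by
    have h1 := intervalIntegral.smul_integral_comp_add_mul (a := 0) (b := 1) (deriv f) u s
    rw [h1, intervalIntegral.integral_deriv_eq_sub (fun x _ => hfd x)
      (hf₁c.intervalIntegrable _ _)]
    simp
  have hincr (u s : ℝ) : ∃ s' ∈ Ico 0 L, f (s + u) - f s = f (s' + u) - f s' := by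
    have hp : Function.Periodic (fun s => f (s + u) - f s) L := fun s => by
      change f (s + L + u) - f (s + L) = _
      rw [show s + L + u = s + u + L by ring, hper, hper]
    exact hp.exists_mem_Ico₀ hL s
  have hne (s : ℝ) {u : ℝ} (hu0 : u ≠ 0) (hu : |u| < L) : f (s + u) - f s ≠ 0 := by
    obtain ⟨s', hs', he⟩ := hincr u s
    rw [he, sub_ne_zero]
    obtain ⟨hu1, hu2⟩ := abs_lt.1 hu
    intro h
    rcases lt_or_ge (s' + u) 0 with h1 | h1
    · rw [← hper] at h
      have := hinj ⟨by linarith [hs'.1], by linarith⟩ hs' h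
      linarith
    · rcases lt_or_ge (s' + u) L with h2 | h2
      · have := hinj ⟨h1, h2⟩ hs' h
        exact hu0 (by linarith)
      · rw [← hper.sub_eq] at h
        have := hinj ⟨by linarith, by linarith [hs'.2]⟩ hs' h
        linarith
  have hq0 : ∀ z ∈ Icc 0 L ×ˢ Icc (-(L / 2)) (L / 2), q z ≠ 0 := by
    rintro ⟨s, u⟩ ⟨-, hu⟩ h0
    rcases eq_or_ne u 0 with rfl | hu0
    · exact hreg s (by simpa [q] using h0)
    · refine hne s hu0 ((abs_le.2 hu).trans_lt (by linarith)) ?_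
      rw [← hqf, h0, smul_zero]
  obtain ⟨z₀, hz₀, hmin⟩ := ((isCompact_Icc (a := (0:ℝ)) (b := L)).prod
    (isCompact_Icc (a := -(L / 2)) (b := L / 2))).exists_isMinOn
    ⟨(0, 0), ⟨le_rfl, hL.le⟩, by constructor <;> simp only <;> linarith⟩ hq.norm.continuousOn
  refine ⟨‖q z₀‖, M, K, hL, norm_pos_iff.2 (hq0 z₀ hz₀), fun s => (hfd s).hasDerivAt, hper,
    hM 0, fun s t => ?_, fun s t hst => ?_⟩
  · exact convex_univ.norm_image_sub_le_of_norm_deriv_le (fun x _ => hf₁d x)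
      (fun x _ => hK 0 x) (mem_univ t) (mem_univ s)
  · obtain ⟨s', hs', he⟩ := hincr (s - t) t
    rw [add_sub_cancel, ← hqf s'] at he
    rw [he, norm_smul, Real.norm_eq_abs, mul_comm]
    exact mul_le_mul_of_nonneg_left (hmin ⟨Ico_subset_Icc_self hs', abs_le.1 hst⟩) (abs_nonneg _)

lemma writhe_unitInv_eq_of_segment {f : ℝ → E3} {L c M K : ℝ} {P a : E3}
    (hf : ChordArcCurve f (deriv f) L c M K) (hf₁ : ContDiff ℝ 1 (deriv f))
    (h0 : ∀ ε ∈ Icc (0:ℝ) 1, ∀ s, f s - P - ε • a ≠ 0) :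
    writhe (fun s => unitInv (f s - P)) L = writhe (fun s => unitInv (f s - P - a)) L := by
  have hL := hf.period_pos
  have hfc : Continuous f := hf.continuous
  have hf₁c : Continuous (deriv f) := hf₁.continuous
  have hf₂c : Continuous (deriv (deriv f)) := hf₁.continuous_deriv le_rfl
  have hper₁ : Function.Periodic (deriv f) L := hf.periodic_velocity
  have hper₂ : Function.Periodic (deriv (deriv f)) L := fun s => by
    rw [← deriv_comp_add_const, show (fun x => deriv f (x + L)) = deriv f from funext hper₁]
  let clamp (ε : ℝ) : ℝ := projIcc 0 1 zero_le_one ε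
  have hclamp_cont : Continuous clamp := continuous_subtype_val.comp continuous_projIcc
  have hclamp_mem (ε : ℝ) : clamp ε ∈ Icc (0:ℝ) 1 := Subtype.coe_prop _
  have hclamp_of_mem {ε : ℝ} (hε : ε ∈ Icc (0:ℝ) 1) : clamp ε = ε := by
    simp [clamp, projIcc_of_mem zero_le_one hε]
  have hclamp_idem (ε : ℝ) : clamp (clamp ε) = clamp ε := hclamp_of_mem (hclamp_mem ε)
  let x (ε s : ℝ) : E3 := f s - P - clamp ε • a
  have hx0 (ε s : ℝ) : x ε s ≠ 0 := h0 _ (hclamp_mem ε) s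
  have hxN (z : ℝ × ℝ) : dot3 (x z.1 z.2) (x z.1 z.2) ≠ 0 := dot3_self_ne_zero (hx0 _ _)
  have hxc : Continuous fun z : ℝ × ℝ => x z.1 z.2 := by fun_prop
  have hxper (ε : ℝ) : Function.Periodic (x ε) L := fun s => by simp only [x, hf.periodic s]
  have hx_idem (ε s : ℝ) : x (clamp ε) s = x ε s := by simp only [x, hclamp_idem]
  have hinv : Continuous fun z : ℝ × ℝ => (dot3 (x z.1 z.2) (x z.1 z.2))⁻¹ :=
    (hxc.dot3 hxc).inv₀ hxN
  have hh : Continuous fun z : ℝ × ℝ => unitInv (x z.1 z.2) := hinv.smul hxc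
  have hh₁ : Continuous fun z : ℝ × ℝ => unitInvDeriv (x z.1 z.2) (deriv f z.2) := by
    unfold unitInvDeriv
    fun_prop
  have hh₂ : Continuous fun z : ℝ × ℝ =>
      unitInvSecondDeriv (x z.1 z.2) (deriv f z.2) (deriv f z.2) (deriv (deriv f) z.2) := by
    unfold unitInvSecondDeriv
    fun_prop
  obtain ⟨B, hB⟩ := exists_norm_le_of_clamp hL hxc hxper hx_idem
  obtain ⟨M', hM'⟩ := exists_norm_le_of_clamp hL
    (k := fun ε s => unitInvDeriv (x ε s) (deriv f s)) hh₁
    (fun ε s => by simp only [hxper ε s, hper₁ s]) fun ε s => by simp only [← hx_idem ε s]; rfl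
  obtain ⟨K', hK'⟩ := exists_norm_le_of_clamp hL
    (k := fun ε s => unitInvSecondDeriv (x ε s) (deriv f s) (deriv f s) (deriv (deriv f) s)) hh₂
    (fun ε s => by simp only [hxper ε s, hper₁ s, hper₂ s])
    fun ε s => by simp only [← hx_idem ε s]; rfl
  have hBpos : 0 < B := (norm_pos_iff.2 (hx0 0 0)).trans_le (hB 0 0)
  have hxd (ε s : ℝ) : HasDerivAt (x ε) (deriv f s) s :=
    ((hf.hasDerivAt s).sub_const P).sub_const _
  have hcurve (ε : ℝ) : ChordArcCurve (fun s => unitInv (x ε s))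
      (fun s => unitInvDeriv (x ε s) (deriv f s)) L (c / B ^ 2) M' K' := by
    refine ⟨hL, div_pos hf.chord_pos (by positivity),
      fun s => hasDerivAt_unitInv (hxd ε s) (hx0 ε s), fun s => by simp only [hxper ε s], hM' ε,
      fun s t => ?_, fun s t hst => ?_⟩
    · exact convex_univ.norm_image_sub_le_of_norm_hasDerivWithin_le
        (fun s _ => (hasDerivAt_unitInvDeriv (hxd ε s)
          (hf₁.differentiable one_ne_zero s).hasDerivAt (hx0 ε s)).hasDerivWithinAt)
        (fun s _ => hK' ε s) (mem_univ t) (mem_univ s)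
    · rw [norm_unitInv_sub (hx0 ε s) (hx0 ε t), show x ε s - x ε t = f s - f t by
        simp only [x]; abel, div_mul_eq_mul_div, pow_two]
      have := norm_pos_iff.2 (hx0 ε s)
      have := norm_pos_iff.2 (hx0 ε t)
      exact div_le_div₀ (norm_nonneg _) (hf.chord s t hst) (by positivity)
        (mul_le_mul (hB ε s) (hB ε t) (norm_nonneg _) hBpos.le)
  have hxε {ε : ℝ} (hε : ε ∈ Ioo (0:ℝ) 1) (s : ℝ) : HasDerivAt (fun ε => x ε s) (-a) ε := by
    have h1 : HasDerivAt (fun ε : ℝ => f s - P - ε • a) (-a) ε := by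
      simpa using ((hasDerivAt_id ε).smul_const a).const_sub (f s - P)
    refine h1.congr_of_eventuallyEq ?_
    filter_upwards [Ioo_mem_nhds hε.1 hε.2] with ε' hε'
    simp only [x, hclamp_of_mem (Ioo_subset_Icc_self hε')]
  have key := writhe_eq_of_conformalField (h := fun ε s => unitInv (x ε s))
    (h₁ := fun ε s => unitInvDeriv (x ε s) (deriv f s)) (a := a) hh hh₁ hcurve
    (fun ε hε s => unitInvDeriv_neg (hx0 ε s) a ▸ hasDerivAt_unitInv (hxε hε s) (hx0 ε s))
    (fun ε hε s => unitInvSecondDeriv_neg (hx0 ε s) a _ ▸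
      hasDerivAt_unitInvDeriv (hxε hε s) (hasDerivAt_const ε (deriv f s)) (hx0 ε s))
  simpa [x, clamp] using key

lemma mem_osculatingCircleArc (f : ℝ → E3) (s : ℝ) (hκ : 0 < ‖deriv (deriv f) s‖) :
    f s ∈ osculatingCircleArc f s := by
  refine ⟨⟨0, 0, by simp⟩, ?_⟩
  rw [sub_add_cancel_left, norm_neg, norm_smul, e2, norm_smul, norm_inv, norm_norm,
    inv_mul_cancel₀ hκ.ne', mul_one]

/-- The writhe of the inverted knot is constant along a continuous
path of inversion centers avoiding the curvature tube: if `P(t)` is continuous on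
`[0,1]`, each `P(t)` lies outside the curvature tube of `f`, and each inverted curve
`I_{P(t),1} ∘ f` has nowhere vanishing curvature, then
`Wr(I_{P(0),r₀} ∘ f) = Wr(I_{P(1),r₁} ∘ f)`. -/
theorem writhe_constant_along_path_of_centers
    (f : ℝ → E3) (L : ℝ) (hL : 0 < L)
    (hf : ContDiff ℝ (⊤ : ℕ∞) f) (hper : Function.Periodic f L)
    (harc : ∀ s, ‖deriv f s‖ = 1) (hinj : Set.InjOn f (Set.Ico 0 L))
    (hκ : ∀ s, ‖deriv (deriv f) s‖ > 0)
    (P : ℝ → E3) (hPcont : ContinuousOn P (Set.Icc 0 1))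
    (hPt : ∀ t ∈ Set.Icc (0:ℝ) 1, P t ∉ curvatureTube f)
    (r₀ r₁ : ℝ) (hr₀ : 0 < r₀) (hr₁ : 0 < r₁)
    (hreg : ∀ t ∈ Set.Icc (0:ℝ) 1, ∀ s,
      cross3 (deriv (fun x => inv3 (P t) 1 (f x)) s)
        (deriv (deriv (fun x => inv3 (P t) 1 (f x))) s) ≠ 0) :
    writhe (fun s => inv3 (P 0) r₀ (f s)) L
      = writhe (fun s => inv3 (P 1) r₁ (f s)) L := by

  have hf₁ : ContDiff ℝ (⊤ : ℕ∞) (deriv f) := hf.deriv'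
  obtain ⟨c, M, K, hcurve⟩ := exists_chordArcCurve hL hf hper
    (fun s h => by simpa [h] using harc s) hinj
  rw [writhe_inv3 f L (P 0) hr₀, writhe_inv3 f L (P 1) hr₁]
  have hclosed : IsClosed (range f) := by
    rw [← hper.image_Icc hL 0]
    exact (isCompact_Icc.image hf.continuous).isClosed
  have hout : ∀ t ∈ Icc (0:ℝ) 1, P t ∈ (range f)ᶜ := by
    rintro t ht ⟨s, hs⟩
    exact hPt t ht (mem_iUnion.2 ⟨s, hs ▸ mem_osculatingCircleArc f s (hκ s)⟩)
  refine (isPreconnected_Icc (a := (0:ℝ)) (b := 1)).induction₂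
    (fun t t' => writhe (fun s => unitInv (f s - P t)) L =
      writhe (fun s => unitInv (f s - P t')) L) (fun t ht => ?_)
    (fun _ _ _ _ _ _ => Eq.trans) (fun _ _ _ _ => Eq.symm)
    (left_mem_Icc.2 zero_le_one) (right_mem_Icc.2 zero_le_one)
  obtain ⟨δ, hδ, hball⟩ := Metric.isOpen_iff.1 hclosed.isOpen_compl _ (hout t ht)
  filter_upwards [hPcont t ht (Metric.ball_mem_nhds _ hδ)] with t' ht'
  have h := writhe_unitInv_eq_of_segment (P := P t) (a := P t' - P t) hcurve
    (hf₁.of_le (by exact_mod_cast le_top)) fun ε hε s h0 => ?_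
  · simpa using h
  · refine hball ((convex_ball (P t) δ).add_smul_sub_mem (Metric.mem_ball_self hδ) ht' hε) ⟨s, ?_⟩
    rwa [sub_sub, sub_eq_zero] at h0
end
end
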